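/- arXiv:1712.06133 — 8 statements merged into one kernel-verified Lean document; each statement's English description precedes it below -/
import Mathlib

section
/- Let a = x + iy with y > 0 and |x| > 1, and let p(z) = (z² − 1)(z − a)(z − ā). Let f : [−1,1] → ℂ be any continuous function such that f(s)² = p(x + i s y) for all s ∈ [−1,1] (i.e., f is a continuous branch of √p along the vertical segment from ā to a). Then Re( i y · ∫_{−1}^{1} f(s) ds ) = 0; that is, Re ∫_{ā}^{a} √p(t) dt = 0, so the necessary condition for a short trajectory connecting a and ā is satisfied. -/
/-- A continuous function on `[-1, 1]` whose square is conjugated by `s ↦ -s` and does not vanish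
on `(-1, 1)` is itself conjugated by `s ↦ -s` there, provided that it is real at `0`. -/
theorem eqOn_conj_comp_neg_of_sq {f : ℝ → ℂ} (hf : ContinuousOn f (Set.Ioo (-1 : ℝ) 1))
    (hsq : ∀ s ∈ Set.Ioo (-1 : ℝ) 1, f s ^ 2 = (starRingEnd ℂ (f (-s))) ^ 2)
    (hne : ∀ s ∈ Set.Ioo (-1 : ℝ) 1, f s ≠ 0) (h0 : (f 0).im = 0) :
    Set.EqOn f (fun s => starRingEnd ℂ (f (-s))) (Set.Ioo (-1 : ℝ) 1) := by
  have hneg : Set.MapsTo (fun s : ℝ => -s) (Set.Ioo (-1 : ℝ) 1) (Set.Ioo (-1 : ℝ) 1) :=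
    fun s hs => ⟨by linarith [hs.2], by linarith [hs.1]⟩
  refine isPreconnected_Ioo.eq_of_sq_eq hf ?_ (fun s hs => by simpa using hsq s hs) ?_
    (y := 0) (by norm_num) ?_
  · exact Complex.continuous_conj.comp_continuousOn (hf.comp continuous_neg.continuousOn hneg)
  · intro s hs
    simpa using hne _ (hneg hs)
  · simpa using (Complex.conj_eq_iff_im.mpr h0).symm

open Complex in
/-- Let `a = x + iy` with `y > 0`, `|x| > 1`, and `p(z) = (z²−1)(z−a)(z−conj a)`.
If `f` is a continuous branch of `√p` along the vertical segment `s ↦ x + isy`,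
`s ∈ [−1,1]`, then `Re(iy · ∫_{−1}^{1} f(s) ds) = 0`, i.e. `Re ∫_{ā}^{a} √p = 0`. -/
theorem stmt_1 (x y : ℝ) (hy : 0 < y) (hx : 1 < |x|) (f : ℝ → ℂ)
    (hf : ContinuousOn f (Set.Icc (-1 : ℝ) 1))
    (hf2 : ∀ s ∈ Set.Icc (-1 : ℝ) 1,
      f s ^ 2 = ((x + s * y * I) ^ 2 - 1) * ((x + s * y * I) - (x + y * I))
          * ((x + s * y * I) - (x - y * I))) :
    (I * y * ∫ s in (-1 : ℝ)..1, f s).re = 0 := by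
  have hx2 : 1 < x ^ 2 := (one_lt_sq_iff_one_lt_abs x).mpr hx
  have hsq : ∀ s ∈ Set.Icc (-1 : ℝ) 1,
      f s ^ 2 = ((x + s * y * I) ^ 2 - 1) * ((1 - s ^ 2) * y ^ 2) := by
    intro s hs
    rw [hf2 s hs]
    linear_combination ((x + s * y * I) ^ 2 - 1) * ((s : ℂ) ^ 2 - 1) * (y : ℂ) ^ 2 * I_sq
  have him : (f 0).im = 0 := by
    have h := hsq 0 (by norm_num)
    have hre := congrArg re h
    have him := congrArg im h
    simp [pow_two] at hre him
    have hpos : 0 < (x * x - 1) * (y * y) := mul_pos (by nlinarith) (by positivity)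
    rcases mul_eq_zero.mp (show (f 0).re * (f 0).im = 0 by linarith) with h' | h'
    · rw [h'] at hre
      nlinarith [mul_self_nonneg (f 0).im]
    · exact h'
  have hIoo : Set.EqOn f (fun s => starRingEnd ℂ (f (-s))) (Set.Ioo (-1 : ℝ) 1) := by
    refine eqOn_conj_comp_neg_of_sq (hf.mono Set.Ioo_subset_Icc_self) ?_ ?_ him
    · intro s hs
      rw [hsq s ⟨hs.1.le, hs.2.le⟩, ← map_pow, hsq (-s) ⟨by linarith [hs.2], by linarith [hs.1]⟩]
      simp
    · intro s hs h
      have h1 := hsq s ⟨hs.1.le, hs.2.le⟩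
      rw [h, zero_pow two_ne_zero, eq_comm, mul_eq_zero] at h1
      rcases h1 with h1 | h1
      · have hre := congrArg re h1
        have him := congrArg im h1
        simp [pow_two] at hre him
        have hxne : x ≠ 0 := by rintro rfl; norm_num at hx2
        have hsy : s * y = 0 := by
          have : x * (s * y) = 0 := by linarith
          exact (mul_eq_zero.mp this).resolve_left hxne
        rw [hsy] at hre
        nlinarith
      · have h2 : (1 - s ^ 2) * y ^ 2 = 0 := by exact_mod_cast h1
        have h3 : 0 < 1 - s ^ 2 := by nlinarith [hs.1, hs.2]
        exact (mul_pos h3 (pow_pos hy 2)).ne' h2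
  have hconj : starRingEnd ℂ (∫ s in (-1 : ℝ)..1, f s) = ∫ s in (-1 : ℝ)..1, f s := by
    calc starRingEnd ℂ (∫ s in (-1 : ℝ)..1, f s)
        = ∫ s in (-1 : ℝ)..1, starRingEnd ℂ (f s) := by
          simp only [intervalIntegral.integral_of_le (show (-1 : ℝ) ≤ 1 by norm_num)]
          exact integral_conj.symm
      _ = ∫ s in (-1 : ℝ)..1, starRingEnd ℂ (f (-s)) := by
          rw [intervalIntegral.integral_comp_neg (fun s => starRingEnd ℂ (f s)), neg_neg]
      _ = ∫ s in (-1 : ℝ)..1, f s := by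
          simp only [intervalIntegral.integral_of_le (show (-1 : ℝ) ≤ 1 by norm_num),
            MeasureTheory.integral_Ioc_eq_integral_Ioo]
          exact MeasureTheory.setIntegral_congr_fun measurableSet_Ioo hIoo.symm
  have hreal := conj_eq_iff_im.mp hconj
  simp [hreal]
end

section
/- For every y > 0, ∫_0^1 √( t·y·(1 − t²) ) · Re( (t·y − 2i)^{1/2} ) dt > 0, where w^{1/2} = exp((1/2)·Log w) is the principal complex square root and the outer square root is the real square root. In particular this integral is nonzero, which shows that the set Γ = { z ∈ ℂ : Re ∫_0^z √((t−z)(t−z̄)(t²−1)) dt = 0 } meets the vertical ray { Re z = 1, Im z ≥ 0 } only at the point z = 1. -/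
/-- The principal square root of a complex number off the closed negative real axis has positive
real part. -/
theorem re_exp_half_log_pos {w : ℂ} (hw : w ∈ Complex.slitPlane) :
    0 < (Complex.exp ((1 / 2) * Complex.log w)).re := by
  have him : ((1 / 2 : ℂ) * Complex.log w).im = w.arg / 2 := by
    rw [show (1 / 2 : ℂ) = ((1 / 2 : ℝ) : ℂ) by push_cast; rfl, Complex.im_ofReal_mul,
      Complex.log_im]
    ring
  rw [Complex.exp_re, him]
  have hlt : w.arg < Real.pi :=
    lt_of_le_of_ne (Complex.arg_le_pi w) (Complex.mem_slitPlane_iff_arg.1 hw).1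
  have hgt := Complex.neg_pi_lt_arg w
  exact mul_pos (Real.exp_pos _) (Real.cos_pos_of_mem_Ioo ⟨by linarith, by linarith⟩)

open Complex in
/-- For every `y > 0`, `∫_0^1 √(ty(1−t²)) · Re((ty − 2i)^{1/2}) dt > 0`, where
`w^{1/2} = exp((1/2)·Log w)` is the principal complex square root. -/
theorem stmt_6 (y : ℝ) (hy : 0 < y) :
    0 < ∫ t in (0 : ℝ)..1,
      Real.sqrt (t * y * (1 - t ^ 2)) *
        (Complex.exp ((1 / 2) * Complex.log ((t * y : ℝ) - 2 * I))).re := by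
  have hslit (t : ℝ) : ((t * y : ℝ) - 2 * I : ℂ) ∈ Complex.slitPlane :=
    Complex.mem_slitPlane_iff.2 (Or.inr (by simp))
  have hlog : Continuous fun t : ℝ => Complex.log ((t * y : ℝ) - 2 * I) :=
    Continuous.clog (by fun_prop) hslit
  refine intervalIntegral.intervalIntegral_pos_of_pos_on
    (Continuous.intervalIntegrable ?_ 0 1) (fun t ht => ?_) one_pos
  · exact (by fun_prop : Continuous fun t : ℝ => Real.sqrt (t * y * (1 - t ^ 2))).mul
      (Complex.continuous_re.comp (Complex.continuous_exp.comp (continuous_const.mul hlog)))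
  · have h : 0 < 1 - t ^ 2 := by nlinarith [ht.1, ht.2]
    exact mul_pos (Real.sqrt_pos.2 (mul_pos (mul_pos ht.1 hy) h)) (re_exp_half_log_pos (hslit t))
end

section
/- Fix y > 0 and define F(x, y) = ∫_1^x √( ((u − x)² + y²)·(u² − 1) ) du for x ≥ 1 (real square root; the integrand is nonnegative on [1, x]). Then the map x ↦ F(x, y) is strictly increasing on (1, ∞). -/
/-- For fixed `y > 0`, the function
`x ↦ F(x,y) = ∫_1^x √(((u−x)² + y²)(u²−1)) du` is strictly increasing on `(1,∞)`. -/
theorem stmt_8 (y : ℝ) (hy : 0 < y) :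
    StrictMonoOn
      (fun x : ℝ => ∫ u in (1 : ℝ)..x, Real.sqrt (((u - x) ^ 2 + y ^ 2) * (u ^ 2 - 1)))
      (Set.Ioi 1) := by
  intro a ha b _ hab
  have ha : 1 < a := ha
  have hcont (x : ℝ) :
      Continuous fun u : ℝ => Real.sqrt (((u - x) ^ 2 + y ^ 2) * (u ^ 2 - 1)) := by
    fun_prop
  have hle : (∫ u in (1 : ℝ)..a, Real.sqrt (((u - a) ^ 2 + y ^ 2) * (u ^ 2 - 1))) ≤
      ∫ u in (1 : ℝ)..a, Real.sqrt (((u - b) ^ 2 + y ^ 2) * (u ^ 2 - 1)) := by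
    refine intervalIntegral.integral_mono_on ha.le ((hcont a).intervalIntegrable _ _)
      ((hcont b).intervalIntegrable _ _) fun u hu => Real.sqrt_le_sqrt ?_
    have hu1 : 0 ≤ u ^ 2 - 1 := by nlinarith [hu.1]
    have hsq : (u - a) ^ 2 ≤ (u - b) ^ 2 := by nlinarith [hu.2]
    gcongr
  have hpos : 0 < ∫ u in a..b, Real.sqrt (((u - b) ^ 2 + y ^ 2) * (u ^ 2 - 1)) := by
    refine intervalIntegral.intervalIntegral_pos_of_pos_on
      ((hcont b).intervalIntegrable _ _) (fun u hu => Real.sqrt_pos.2 ?_) hab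
    have hu1 : 0 < u ^ 2 - 1 := by nlinarith [hu.1]
    positivity
  have hadd := intervalIntegral.integral_add_adjacent_intervals
    ((hcont b).intervalIntegrable (μ := MeasureTheory.volume) 1 a)
    ((hcont b).intervalIntegrable a b)
  dsimp only
  linarith
end

section
/- Fix y > 0 and define G(x, y) = Re( ∫_0^1 i·y²·( (1 − t²)·((x + i t y)² − 1) )^{1/2} dt ) for x > 1, where w^{1/2} = exp((1/2)·Log w) is the principal complex square root. Then the map x ↦ G(x, y) is strictly increasing on (1, ∞). -/
open Complex in
/-- The exponential form of the principal square root squares back to its argument. -/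
theorem exp_half_log_sq {z : ℂ} (hz : z ≠ 0) : exp (1 / 2 * log z) ^ 2 = z := by
  rw [← exp_nat_mul, ← mul_assoc]
  norm_num
  exact exp_log hz

open Complex in
theorem exp_half_log_re_pos {z : ℂ} (hz : z ∈ slitPlane) : 0 < (exp (1 / 2 * log z)).re := by
  have him : (1 / 2 * log z).im = arg z / 2 := by
    rw [← log_im, show (1 / 2 : ℂ) = ((1 / 2 : ℝ) : ℂ) by norm_num, im_ofReal_mul]
    ring
  have hlt : arg z < Real.pi := lt_of_le_of_ne (arg_le_pi z) (mem_slitPlane_iff_arg.1 hz).1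
  have hgt := neg_pi_lt_arg z
  rw [exp_re, him]
  exact mul_pos (Real.exp_pos _) (Real.cos_pos_of_mem_Ioo ⟨by linarith, by linarith⟩)

open Complex in
theorem add_mul_I_sq_sub_one_mem_slitPlane {x : ℝ} (hx : 1 < x) (b : ℝ) :
    ((x : ℂ) + b * I) ^ 2 - 1 ∈ slitPlane := by
  rw [mem_slitPlane_iff]
  by_cases hb : b = 0
  · left
    simp [hb, pow_two]
    nlinarith
  · right
    simp [pow_two]
    intro h
    apply hb
    nlinarith

/-- Along a horizontal line, the imaginary part `v` of `√(ζ² - 1) = u + iv` decreases as the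
real part of `ζ = x + ib` grows. -/
theorem im_lt_of_sq_eq {x₁ x₂ b u₁ v₁ u₂ v₂ : ℝ} (hx₁ : 0 < x₁) (hx : x₁ < x₂) (hb : 0 < b)
    (hu₁ : 0 < u₁) (hu₂ : 0 < u₂) (hi₁ : u₁ * v₁ = x₁ * b) (hi₂ : u₂ * v₂ = x₂ * b)
    (hr₁ : u₁ ^ 2 - v₁ ^ 2 = x₁ ^ 2 - b ^ 2 - 1) (hr₂ : u₂ ^ 2 - v₂ ^ 2 = x₂ ^ 2 - b ^ 2 - 1) :
    v₂ < v₁ := by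
  have hv₁ : 0 < v₁ := pos_of_mul_pos_right (hi₁ ▸ mul_pos hx₁ hb) hu₁.le
  have hv₂ : 0 < v₂ := pos_of_mul_pos_right (hi₂ ▸ mul_pos (hx₁.trans hx) hb) hu₂.le
  have hq₁ : v₁ ^ 2 * (v₁ ^ 2 - b ^ 2 - 1) + x₁ ^ 2 * (v₁ ^ 2 - b ^ 2) = 0 := by
    linear_combination (u₁ * v₁ + x₁ * b) * hi₁ - v₁ ^ 2 * hr₁
  have hq₂ : v₂ ^ 2 * (v₂ ^ 2 - b ^ 2 - 1) + x₂ ^ 2 * (v₂ ^ 2 - b ^ 2) = 0 := by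
    linear_combination (u₂ * v₂ + x₂ * b) * hi₂ - v₂ ^ 2 * hr₂
  have hsq : x₁ ^ 2 < x₂ ^ 2 := by nlinarith
  have hvb : 0 < v₁ ^ 2 - b ^ 2 := by
    have hpos : 0 < v₁ ^ 2 := by positivity
    have : 0 < (v₁ ^ 2 + x₁ ^ 2) * (v₁ ^ 2 - b ^ 2) := by linarith
    exact pos_of_mul_pos_right this (by positivity)
  by_contra! hle
  have hV : v₁ ^ 2 ≤ v₂ ^ 2 := by nlinarith
  have hgap : 0 < (x₂ ^ 2 - x₁ ^ 2) * (v₁ ^ 2 - b ^ 2) := mul_pos (by linarith) hvb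
  have hinc : 0 ≤ (v₂ ^ 2 - v₁ ^ 2) * (v₁ ^ 2 + u₂ ^ 2) :=
    mul_nonneg (by linarith) (by positivity)
  have heq : (v₂ ^ 2 - v₁ ^ 2) * (v₁ ^ 2 + u₂ ^ 2) =
      -((x₂ ^ 2 - x₁ ^ 2) * (v₁ ^ 2 - b ^ 2)) := by
    linear_combination (v₂ ^ 2 - v₁ ^ 2) * hr₂ + hq₂ - hq₁
  linarith

open Complex in
theorem exp_half_log_im_lt {x₁ x₂ b : ℝ} (hx₁ : 1 < x₁) (hx : x₁ < x₂) (hb : 0 < b) :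
    (exp (1 / 2 * log (((x₂ : ℂ) + b * I) ^ 2 - 1))).im <
      (exp (1 / 2 * log (((x₁ : ℂ) + b * I) ^ 2 - 1))).im := by
  have key : ∀ x : ℝ, 1 < x → ∀ w : ℂ, w = exp (1 / 2 * log (((x : ℂ) + b * I) ^ 2 - 1)) →
      0 < w.re ∧ w.re * w.im = x * b ∧ w.re ^ 2 - w.im ^ 2 = x ^ 2 - b ^ 2 - 1 := by
    intro x hx w hw
    have hs := add_mul_I_sq_sub_one_mem_slitPlane hx b
    have hsq : w ^ 2 = ((x : ℂ) + b * I) ^ 2 - 1 := hw ▸ exp_half_log_sq (slitPlane_ne_zero hs)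
    have hre := congrArg re hsq
    have him := congrArg im hsq
    simp [pow_two] at hre him
    exact ⟨hw ▸ exp_half_log_re_pos hs, by linarith, by linarith⟩
  obtain ⟨hu₁, hi₁, hr₁⟩ := key x₁ hx₁ _ rfl
  obtain ⟨hu₂, hi₂, hr₂⟩ := key x₂ (hx₁.trans hx) _ rfl
  exact im_lt_of_sq_eq (by linarith) hx hb hu₁ hu₂ hi₁ hi₂ hr₁ hr₂

open Complex in
theorem exp_half_log_ofReal_mul {r : ℝ} (hr : 0 < r) {z : ℂ} (hz : z ≠ 0) :
    exp (1 / 2 * log (r * z)) = (√r : ℂ) * exp (1 / 2 * log z) := by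
  rw [log_ofReal_mul hr hz, mul_add, exp_add, Real.sqrt_eq_rpow, Real.rpow_def_of_pos hr]
  push_cast
  ring_nf

open Complex in
theorem continuous_exp_half_log {x : ℝ} (hx : 1 < x) (y : ℝ) :
    Continuous fun t : ℝ => exp (1 / 2 * log (((x : ℂ) + (t * y : ℝ) * I) ^ 2 - 1)) := by
  refine continuous_exp.comp (continuous_const.mul (Continuous.clog (by fun_prop) fun t => ?_))
  exact add_mul_I_sq_sub_one_mem_slitPlane hx _

open Complex in
/-- The contribution of the vertical segment as a real integral with a continuous integrand. -/
theorem re_integral_eq {x : ℝ} (hx : 1 < x) (y : ℝ) :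
    (∫ t in (0 : ℝ)..1, I * (y : ℂ) ^ 2 *
      exp ((1 / 2) * log ((1 - (t : ℂ) ^ 2) * (((x : ℂ) + t * y * I) ^ 2 - 1)))).re =
    ∫ t in (0 : ℝ)..1, -(y ^ 2 * √(1 - t ^ 2) *
      (exp (1 / 2 * log (((x : ℂ) + (t * y : ℝ) * I) ^ 2 - 1))).im) := by
  have hcont := continuous_exp_half_log hx y
  have hcongr : (∫ t in (0 : ℝ)..1, I * (y : ℂ) ^ 2 *
      exp ((1 / 2) * log ((1 - (t : ℂ) ^ 2) * (((x : ℂ) + t * y * I) ^ 2 - 1)))) =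
      ∫ t in (0 : ℝ)..1, I * ((y ^ 2 * √(1 - t ^ 2) : ℝ) : ℂ) *
        exp (1 / 2 * log (((x : ℂ) + (t * y : ℝ) * I) ^ 2 - 1)) := by
    rw [intervalIntegral.integral_of_le zero_le_one, intervalIntegral.integral_of_le zero_le_one,
      MeasureTheory.integral_Ioc_eq_integral_Ioo, MeasureTheory.integral_Ioc_eq_integral_Ioo]
    refine MeasureTheory.setIntegral_congr_fun measurableSet_Ioo fun t ht => ?_
    have h : (0 : ℝ) < 1 - t ^ 2 := by nlinarith [ht.1, ht.2]
    have hz := slitPlane_ne_zero (add_mul_I_sq_sub_one_mem_slitPlane hx (t * y))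
    have := exp_half_log_ofReal_mul h hz
    push_cast at this ⊢
    rw [this]
    ring
  rw [hcongr, ← reCLM_apply, ← reCLM.intervalIntegral_comp_comm
    (Continuous.intervalIntegrable (by fun_prop) _ _)]
  refine intervalIntegral.integral_congr fun t _ => ?_
  simp only [reCLM_apply, mul_assoc I]
  rw [I_mul_re, im_ofReal_mul]

open Complex in
/-- For fixed `y > 0`, the function
`x ↦ G(x,y) = Re ∫_0^1 i y² ((1−t²)((x+ity)²−1))^{1/2} dt` (principal square root)
is strictly increasing on `(1,∞)`. -/
theorem stmt_9 (y : ℝ) (hy : 0 < y) :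
    StrictMonoOn
      (fun x : ℝ =>
        (∫ t in (0 : ℝ)..1, I * (y : ℂ) ^ 2 *
          Complex.exp ((1 / 2) *
            Complex.log ((1 - (t : ℂ) ^ 2) * (((x : ℂ) + t * y * I) ^ 2 - 1)))).re)
      (Set.Ioi 1) := by
  intro x₁ hx₁ x₂ hx₂ hx
  have hc₁ := continuous_exp_half_log hx₁ y
  have hc₂ := continuous_exp_half_log hx₂ y
  simp only [re_integral_eq hx₁, re_integral_eq hx₂]
  refine intervalIntegral.integral_lt_integral_of_continuousOn_of_le_of_exists_lt zero_lt_one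
    (Continuous.continuousOn (by fun_prop)) (Continuous.continuousOn (by fun_prop)) ?_
    ⟨1 / 2, by norm_num, ?_⟩
  · intro t ht
    have h := exp_half_log_im_lt hx₁ hx (mul_pos ht.1 hy)
    exact neg_le_neg (mul_le_mul_of_nonneg_left h.le (by positivity))
  · have h := exp_half_log_im_lt hx₁ hx (mul_pos (one_half_pos (α := ℝ)) hy)
    have hs : 0 < √(1 - (1 / 2 : ℝ) ^ 2) := Real.sqrt_pos.2 (by norm_num)
    exact neg_lt_neg (mul_lt_mul_of_pos_left h (by positivity))
end

section
/- Define, for x > 1 and y > 0, F(x, y) = ∫_1^x √( ((u − x)² + y²)(u² − 1) ) du (real square root) and G(x, y) = Re( ∫_0^1 i·y²·( (1 − t²)((x + i t y)² − 1) )^{1/2} dt ) (principal complex square root). Then for each fixed y > 0, there is at most one x ∈ (1, ∞) with F(x, y) + G(x, y) = 0. -/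
/-- The positive root `B` of `B² + (X - m - 1) B - X m` is antitone in `X`. -/
theorem quadratic_positive_root_antitone {B₁ B₂ X₁ X₂ m : ℝ} (hB₁ : 0 < B₁) (hB₂ : 0 < B₂)
    (hm : 0 < m) (hX₁ : 0 < X₁) (hX : X₁ ≤ X₂)
    (h₁ : X₁ * m = B₁ * (B₁ + (X₁ - m - 1)))
    (h₂ : X₂ * m = B₂ * (B₂ + (X₂ - m - 1))) : B₂ ≤ B₁ := by
  by_contra! hlt
  have hmB : m ≤ B₂ := by
    by_contra! hB
    nlinarith [mul_pos (sub_pos.2 hB) (hX₁.trans_le hX), mul_pos (sub_pos.2 hB) hB₂]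
  have h₃ : B₂ * (B₂ + (X₁ - m - 1)) - X₁ * m ≤ 0 := by
    nlinarith [mul_nonneg (sub_nonneg.2 hX) (sub_nonneg.2 hmB)]
  have h₄ : 0 < (B₂ - B₁) * (B₁ * B₂ + X₁ * m) :=
    mul_pos (sub_pos.2 hlt) (by positivity)
  have h₅ := mul_nonneg hB₁.le (neg_nonneg.2 h₃)
  have h₆ : B₂ * (X₁ * m) = B₂ * (B₁ * (B₁ + (X₁ - m - 1))) := by rw [h₁]
  linarith

/-- The principal square root of a point of the upper half plane lies in the open first
quadrant. -/
theorem exp_half_log_of_im_pos {z : ℂ} (hz : 0 < z.im) :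
    let s := Complex.exp ((1 / 2) * Complex.log z)
    0 < s.im ∧ s.re ^ 2 - s.im ^ 2 = z.re ∧ 2 * (s.re * s.im) = z.im := by
  intro s
  have hz0 : z ≠ 0 := by
    rintro rfl
    simp at hz
  have hs : s ^ 2 = z := by
    rw [← Complex.exp_nat_mul]
    rw [show ((2 : ℕ) : ℂ) * (1 / 2 * Complex.log z) = Complex.log z by push_cast; ring]
    exact Complex.exp_log hz0
  have harg : 0 < z.arg := by
    refine lt_of_le_of_ne (Complex.arg_nonneg_iff.2 hz.le) fun h => ?_
    exact hz.ne' (Complex.arg_eq_zero_iff.1 h.symm).2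
  have him : ((1 / 2 : ℂ) * Complex.log z).im = z.arg / 2 := by
    rw [show (1 / 2 : ℂ) = ((1 / 2 : ℝ) : ℂ) by push_cast; rfl, Complex.im_ofReal_mul,
      Complex.log_im]
    ring
  refine ⟨?_, ?_, ?_⟩
  · change 0 < (Complex.exp _).im
    rw [Complex.exp_im, him]
    exact mul_pos (Real.exp_pos _)
      (Real.sin_pos_of_pos_of_lt_pi (by linarith) (by linarith [Complex.arg_le_pi z, Real.pi_pos]))
  · rw [← hs, pow_two s, Complex.mul_re]
    ring
  · rw [← hs, pow_two s, Complex.mul_im]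
    ring

theorem norm_exp_half_log_le (z : ℂ) :
    ‖Complex.exp ((1 / 2) * Complex.log z)‖ ≤ 1 + ‖z‖ := by
  have hre : ((1 / 2 : ℂ) * Complex.log z).re = Real.log ‖z‖ / 2 := by
    rw [show (1 / 2 : ℂ) = ((1 / 2 : ℝ) : ℂ) by push_cast; rfl, Complex.re_ofReal_mul,
      Complex.log_re]
    ring
  rw [Complex.norm_exp, hre]
  rcases (norm_nonneg z).eq_or_lt' with h | h
  · simp [h]
  · rcases le_total (Real.log ‖z‖) 0 with hl | hl
    · exact (Real.exp_le_one_iff.2 (by linarith)).trans (by linarith)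
    · calc Real.exp (Real.log ‖z‖ / 2) ≤ Real.exp (Real.log ‖z‖) := by gcongr; linarith
        _ = ‖z‖ := Real.exp_log h
        _ ≤ 1 + ‖z‖ := by linarith

theorem intervalIntegrable_mul_exp_half_log {g : ℝ → ℂ} (hg : Continuous g) (c : ℂ) (a b : ℝ) :
    IntervalIntegrable (fun t => c * Complex.exp ((1 / 2) * Complex.log (g t)))
      MeasureTheory.volume a b := by
  refine IntervalIntegrable.const_mul ?_ c
  refine IntervalIntegrable.mono_fun' (g := fun t => 1 + ‖g t‖)
    (Continuous.intervalIntegrable (by fun_prop) a b) ?_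
    (Filter.Eventually.of_forall fun t => norm_exp_half_log_le _)
  have hgm := hg.measurable
  exact Measurable.aestronglyMeasurable (by fun_prop)

theorem re_I_mul_sq_mul (y : ℝ) (w : ℂ) :
    (Complex.I * (y : ℂ) ^ 2 * w).re = -(y ^ 2 * w.im) := by
  rw [← Complex.ofReal_pow, mul_comm Complex.I, mul_assoc, Complex.re_ofReal_mul, Complex.I_mul_re]
  ring

/-- Monotonicity in `x` of the real part of the integrand of `G`. -/
theorem vertical_integrand_re_mono {x₁ x₂ y t : ℝ} (hx₁ : 1 < x₁) (hx : x₁ ≤ x₂) (hy : 0 < y)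
    (ht : t ∈ Set.Ioo (0 : ℝ) 1) :
    (Complex.I * (y : ℂ) ^ 2 * Complex.exp ((1 / 2) * Complex.log
      ((1 - (t : ℂ) ^ 2) * (((x₁ : ℂ) + t * y * Complex.I) ^ 2 - 1)))).re ≤
    (Complex.I * (y : ℂ) ^ 2 * Complex.exp ((1 / 2) * Complex.log
      ((1 - (t : ℂ) ^ 2) * (((x₂ : ℂ) + t * y * Complex.I) ^ 2 - 1)))).re := by
  obtain ⟨ht0, ht1⟩ := ht
  have hc : 0 < 1 - t ^ 2 := by nlinarith
  have hk : 0 < t * y := mul_pos ht0 hy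
  have hform (x : ℝ) : (1 - (t : ℂ) ^ 2) * (((x : ℂ) + t * y * Complex.I) ^ 2 - 1) =
      ⟨(1 - t ^ 2) * (x ^ 2 - (t * y) ^ 2 - 1), (1 - t ^ 2) * (2 * x * (t * y))⟩ := by
    rw [← Complex.ofReal_one, ← Complex.ofReal_pow, ← Complex.ofReal_sub, ← Complex.ofReal_mul]
    apply Complex.ext
    · rw [Complex.re_ofReal_mul]
      congr 1
      simp [pow_two]
    · rw [Complex.im_ofReal_mul]
      congr 1
      simp [pow_two]
      ring
  have key (x : ℝ) (h : 0 < x) := exp_half_log_of_im_pos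
    (z := ⟨(1 - t ^ 2) * (x ^ 2 - (t * y) ^ 2 - 1), (1 - t ^ 2) * (2 * x * (t * y))⟩)
    (by dsimp only; positivity)
  rw [hform, hform, re_I_mul_sq_mul, re_I_mul_sq_mul]
  have hx₁0 : 0 < x₁ := by linarith
  obtain ⟨hb₁, hr₁, hi₁⟩ := key x₁ hx₁0
  obtain ⟨hb₂, hr₂, hi₂⟩ := key x₂ (by linarith)
  dsimp only at hr₁ hi₁ hr₂ hi₂
  have aux {a b x : ℝ} (hr : a ^ 2 - b ^ 2 = (1 - t ^ 2) * (x ^ 2 - (t * y) ^ 2 - 1))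
      (hi : 2 * (a * b) = (1 - t ^ 2) * (2 * x * (t * y))) :
      x ^ 2 * (t * y) ^ 2 = b ^ 2 / (1 - t ^ 2) *
        (b ^ 2 / (1 - t ^ 2) + (x ^ 2 - (t * y) ^ 2 - 1)) := by
    have h₁ : a * b = (1 - t ^ 2) * (x * (t * y)) := by linarith
    have h₂ : (1 - t ^ 2) ^ 2 * (x ^ 2 * (t * y) ^ 2) =
        b ^ 2 * (b ^ 2 + (1 - t ^ 2) * (x ^ 2 - (t * y) ^ 2 - 1)) := by
      rw [← hr, show (1 - t ^ 2) ^ 2 * (x ^ 2 * (t * y) ^ 2) =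
        ((1 - t ^ 2) * (x * (t * y))) ^ 2 by ring, ← h₁]
      ring
    generalize x ^ 2 - (t * y) ^ 2 - 1 = r at h₂ ⊢
    generalize x ^ 2 * (t * y) ^ 2 = q at h₂ ⊢
    generalize 1 - t ^ 2 = c at *
    field_simp
    linarith
  have hB := quadratic_positive_root_antitone (div_pos (pow_pos hb₁ 2) hc)
    (div_pos (pow_pos hb₂ 2) hc) (pow_pos hk 2) (pow_pos hx₁0 2)
    (pow_le_pow_left₀ hx₁0.le hx 2) (aux hr₁ hi₁) (aux hr₂ hi₂)
  have hb := (pow_le_pow_iff_left₀ hb₂.le hb₁.le two_ne_zero).1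
    ((div_le_div_iff_of_pos_right hc).1 hB)
  exact neg_le_neg (mul_le_mul_of_nonneg_left hb (sq_nonneg y))

/-- Monotonicity of `G` in `x`. -/
theorem vertical_integral_re_mono {x₁ x₂ y : ℝ} (hx₁ : 1 < x₁) (hx : x₁ ≤ x₂) (hy : 0 < y) :
    (∫ t in (0 : ℝ)..1, Complex.I * (y : ℂ) ^ 2 * Complex.exp ((1 / 2) * Complex.log
      ((1 - (t : ℂ) ^ 2) * (((x₁ : ℂ) + t * y * Complex.I) ^ 2 - 1)))).re ≤
    (∫ t in (0 : ℝ)..1, Complex.I * (y : ℂ) ^ 2 * Complex.exp ((1 / 2) * Complex.log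
      ((1 - (t : ℂ) ^ 2) * (((x₂ : ℂ) + t * y * Complex.I) ^ 2 - 1)))).re := by
  have hint (x : ℝ) := intervalIntegrable_mul_exp_half_log
    (g := fun t : ℝ => (1 - (t : ℂ) ^ 2) * (((x : ℂ) + t * y * Complex.I) ^ 2 - 1))
    (by fun_prop) (Complex.I * (y : ℂ) ^ 2) 0 1
  have hre (x : ℝ) := Complex.reCLM.intervalIntegral_comp_comm (hint x)
  simp only [Complex.reCLM_apply] at hre
  rw [← hre, ← hre]
  refine intervalIntegral.integral_mono_on_of_le_Ioo zero_le_one ?_ ?_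
    fun t ht => vertical_integrand_re_mono hx₁ hx hy ht
  · exact ⟨(hint x₁).1.re, (hint x₁).2.re⟩
  · exact ⟨(hint x₂).1.re, (hint x₂).2.re⟩

/-- Strict monotonicity of `F` in `x`. -/
theorem horizontal_integral_strictMono {x₁ x₂ y : ℝ} (hx₁ : 1 < x₁) (hx : x₁ < x₂)
    (hy : 0 < y) :
    (∫ u in (1 : ℝ)..x₁, √(((u - x₁) ^ 2 + y ^ 2) * (u ^ 2 - 1))) <
      ∫ u in (1 : ℝ)..x₂, √(((u - x₂) ^ 2 + y ^ 2) * (u ^ 2 - 1)) := by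
  have hint (x a b : ℝ) : IntervalIntegrable (fun u => √(((u - x) ^ 2 + y ^ 2) * (u ^ 2 - 1)))
      MeasureTheory.volume a b := Continuous.intervalIntegrable (by fun_prop) a b
  rw [← intervalIntegral.integral_add_adjacent_intervals (hint x₂ 1 x₁) (hint x₂ x₁ x₂)]
  have h₁ : (∫ u in (1 : ℝ)..x₁, √(((u - x₁) ^ 2 + y ^ 2) * (u ^ 2 - 1))) ≤
      ∫ u in (1 : ℝ)..x₁, √(((u - x₂) ^ 2 + y ^ 2) * (u ^ 2 - 1)) := by
    refine intervalIntegral.integral_mono_on hx₁.le (hint _ _ _) (hint _ _ _) fun u hu => ?_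
    obtain ⟨hu1, hux⟩ := hu
    refine Real.sqrt_le_sqrt (mul_le_mul_of_nonneg_right ?_ ?_) <;> nlinarith
  have h₂ : 0 < ∫ u in x₁..x₂, √(((u - x₂) ^ 2 + y ^ 2) * (u ^ 2 - 1)) := by
    refine intervalIntegral.intervalIntegral_pos_of_pos_on (hint _ _ _) (fun u hu => ?_) hx
    have hu1 : 0 < u ^ 2 - 1 := by nlinarith [hu.1]
    exact Real.sqrt_pos.2 (mul_pos (by positivity) hu1)
  linarith

open Complex in
/-- For fixed `y > 0`, with `F(x,y) = ∫_1^x √(((u−x)²+y²)(u²−1)) du` and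
`G(x,y) = Re ∫_0^1 i y² ((1−t²)((x+ity)²−1))^{1/2} dt`, there is at most one
`x ∈ (1,∞)` with `F(x,y) + G(x,y) = 0`. -/
theorem stmt_10 (y : ℝ) (hy : 0 < y) :
    ∀ x₁ ∈ Set.Ioi (1 : ℝ), ∀ x₂ ∈ Set.Ioi (1 : ℝ),
      (∫ u in (1 : ℝ)..x₁, Real.sqrt (((u - x₁) ^ 2 + y ^ 2) * (u ^ 2 - 1)))
        + (∫ t in (0 : ℝ)..1, I * (y : ℂ) ^ 2 *
            Complex.exp ((1 / 2) *
              Complex.log ((1 - (t : ℂ) ^ 2) * (((x₁ : ℂ) + t * y * I) ^ 2 - 1)))).re = 0 →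
      (∫ u in (1 : ℝ)..x₂, Real.sqrt (((u - x₂) ^ 2 + y ^ 2) * (u ^ 2 - 1)))
        + (∫ t in (0 : ℝ)..1, I * (y : ℂ) ^ 2 *
            Complex.exp ((1 / 2) *
              Complex.log ((1 - (t : ℂ) ^ 2) * (((x₂ : ℂ) + t * y * I) ^ 2 - 1)))).re = 0 →
      x₁ = x₂ := by
  intro x₁ hx₁ x₂ hx₂ h₁ h₂
  rcases lt_trichotomy x₁ x₂ with h | h | h
  · linarith [horizontal_integral_strictMono hx₁ h hy, vertical_integral_re_mono hx₁ h.le hy]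
  · exact h
  · linarith [horizontal_integral_strictMono hx₂ h hy, vertical_integral_re_mono hx₂ h.le hy]
end

section
/- There exists a unique x in the open interval (0, π/2) satisfying sinh( 2/(3·cot(x)·sin³(x)) − cot(x)/sin(x) ) = cot(x). -/
theorem sinh_argument_eq {x : ℝ} (hs : 0 < Real.sin x) (hc : 0 < Real.cos x) :
    2 / (3 * Real.cot x * Real.sin x ^ 3) - Real.cot x / Real.sin x
      = 2 / (3 * Real.cos x) - Real.cos x / (3 * Real.sin x ^ 2) := by
  rw [Real.cot_eq_cos_div_sin]
  have h := Real.sin_sq_add_cos_sq x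
  field_simp
  linear_combination (-2 : ℝ) * h

theorem sin_pos_and_cos_pos_of_mem_Ioo {x : ℝ} (hx : x ∈ Set.Ioo 0 (Real.pi / 2)) :
    0 < Real.sin x ∧ 0 < Real.cos x :=
  ⟨Real.sin_pos_of_pos_of_lt_pi hx.1 (by linarith [hx.2, Real.pi_pos]),
    Real.cos_pos_of_mem_Ioo ⟨by linarith [hx.1, Real.pi_pos], hx.2⟩⟩

theorem strictMonoOn_sinh_sub_cot :
    StrictMonoOn (fun x : ℝ => Real.sinh (2 / (3 * Real.cos x)
      - Real.cos x / (3 * Real.sin x ^ 2)) - Real.cos x / Real.sin x)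
      (Set.Ioo 0 (Real.pi / 2)) := by
  intro x hx y hy hxy
  obtain ⟨hsx, hcx⟩ := sin_pos_and_cos_pos_of_mem_Ioo hx
  obtain ⟨hsy, hcy⟩ := sin_pos_and_cos_pos_of_mem_Ioo hy
  have hs : Real.sin x < Real.sin y :=
    Real.sin_lt_sin_of_lt_of_le_pi_div_two (by linarith [hx.1, Real.pi_pos]) hy.2.le hxy
  have hc : Real.cos y < Real.cos x :=
    Real.cos_lt_cos_of_nonneg_of_le_pi_div_two hx.1.le hy.2.le hxy
  have h₁ : 2 / (3 * Real.cos x) < 2 / (3 * Real.cos y) := by gcongr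
  have h₂ : Real.cos y / (3 * Real.sin y ^ 2) ≤ Real.cos x / (3 * Real.sin x ^ 2) := by gcongr
  have h₃ : Real.cos y / Real.sin y ≤ Real.cos x / Real.sin x := by gcongr
  have h₄ := Real.sinh_lt_sinh.2 (sub_lt_sub_right h₁ _ |>.trans_le (sub_le_sub_left h₂ _))
  exact (sub_lt_sub_right h₄ _).trans_le (sub_le_sub_left h₃ _)

theorem exists_sinh_sub_cot_eq_zero :
    ∃ x ∈ Set.Ioo 0 (Real.pi / 2), Real.sinh (2 / (3 * Real.cos x)
      - Real.cos x / (3 * Real.sin x ^ 2)) - Real.cos x / Real.sin x = 0 := by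
  have hpi := Real.pi_pos
  have hsub : Set.Icc (Real.pi / 6) (Real.pi / 3) ⊆ Set.Ioo 0 (Real.pi / 2) :=
    fun x hx => ⟨by linarith [hx.1], by linarith [hx.2]⟩
  have hcont : ContinuousOn (fun x : ℝ => Real.sinh (2 / (3 * Real.cos x)
      - Real.cos x / (3 * Real.sin x ^ 2)) - Real.cos x / Real.sin x)
      (Set.Icc (Real.pi / 6) (Real.pi / 3)) := by
    intro x hx
    obtain ⟨hs, hc⟩ := sin_pos_and_cos_pos_of_mem_Ioo (hsub hx)
    apply ContinuousAt.continuousWithinAt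
    have h₁ : 3 * Real.cos x ≠ 0 := by positivity
    have h₂ : 3 * Real.sin x ^ 2 ≠ 0 := by positivity
    have h₃ : Real.sin x ≠ 0 := hs.ne'
    fun_prop (disch := assumption)
  have h3 : (0 : ℝ) < √3 := by positivity
  have h3sq : √3 ^ 2 = (3 : ℝ) := Real.sq_sqrt (by norm_num)
  obtain ⟨x, hx, h⟩ := intermediate_value_Icc (by linarith) hcont (show (0 : ℝ) ∈ _ from by
    refine ⟨?_, ?_⟩
    · simp only [Real.cos_pi_div_six, Real.sin_pi_div_six]
      have h₁ : 2 / (3 * (√3 / 2)) - √3 / 2 / (3 * (1 / 2) ^ 2) ≤ 0 := by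
        rw [sub_nonpos, div_le_div_iff₀ (by positivity) (by norm_num)]
        nlinarith
      have h₂ := Real.sinh_nonpos_iff.2 h₁
      have h₃ : 0 ≤ √3 / 2 / (1 / 2) := by positivity
      linarith
    · simp only [Real.cos_pi_div_three, Real.sin_pi_div_three]
      have h₁ : (2 / (3 * (1 / 2)) - 1 / 2 / (3 * (√3 / 2) ^ 2) : ℝ) = 10 / 9 := by
        rw [div_pow, h3sq]
        norm_num
      have h₂ : (10 / 9 : ℝ) ≤ Real.sinh (10 / 9) := Real.self_le_sinh_iff.2 (by norm_num)
      have h₃ : 1 / 2 / (√3 / 2) ≤ (1 : ℝ) := by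
        rw [div_le_one (by positivity)]
        nlinarith
      rw [h₁]
      linarith)
  exact ⟨x, hsub hx, h⟩

open Real in
/-- There exists a unique `x ∈ (0, π/2)` with
`sinh(2/(3 cot x sin³x) − cot x / sin x) = cot x`. -/
theorem stmt_11 :
    ∃! x : ℝ, x ∈ Set.Ioo 0 (Real.pi / 2) ∧
      Real.sinh (2 / (3 * Real.cot x * Real.sin x ^ 3) - Real.cot x / Real.sin x)
        = Real.cot x := by
  have key : ∀ x ∈ Set.Ioo 0 (Real.pi / 2),
      (Real.sinh (2 / (3 * Real.cot x * Real.sin x ^ 3) - Real.cot x / Real.sin x)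
        = Real.cot x ↔ Real.sinh (2 / (3 * Real.cos x)
      - Real.cos x / (3 * Real.sin x ^ 2)) - Real.cos x / Real.sin x = 0) := by
    intro x hx
    obtain ⟨hs, hc⟩ := sin_pos_and_cos_pos_of_mem_Ioo hx
    rw [sinh_argument_eq hs hc, Real.cot_eq_cos_div_sin, sub_eq_zero]
  obtain ⟨x, hx, h⟩ := exists_sinh_sub_cot_eq_zero
  refine ⟨x, ⟨hx, (key x hx).2 h⟩, ?_⟩
  rintro y ⟨hy, hy'⟩
  exact strictMonoOn_sinh_sub_cot.injOn hy hx (((key y hy).1 hy').trans h.symm)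
end

section
/- The function f : (0, π/2) → ℝ defined by f(x) = sinh( 2/(3·cot(x)·sin³(x)) − cot(x)/sin(x) ) − cot(x) is strictly increasing on (0, π/2). -/
theorem strictAntiOn_two_sub_three_sq_div :
    StrictAntiOn (fun c : ℝ => (2 - 3 * c ^ 2) / (3 * (c * (1 - c ^ 2)))) (Set.Ioo 0 1) := by
  rintro a ⟨ha0, ha1⟩ b ⟨hb0, hb1⟩ hab
  have ha : 0 < 1 - a ^ 2 := by nlinarith
  have hb : 0 < 1 - b ^ 2 := by nlinarith
  have key : 0 < (b - a) * (2 * ((1 - a ^ 2) * (1 - b ^ 2)) + a * b + (a * b) ^ 2) :=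
    mul_pos (sub_pos.2 hab) (by positivity)
  dsimp only
  rw [div_lt_div_iff₀ (by positivity) (by positivity)]
  linear_combination 3 * key

theorem Real.strictAntiOn_cot : StrictAntiOn Real.cot (Set.Ioo 0 Real.pi) := by
  rintro x ⟨hx0, hx1⟩ y ⟨hy0, hy1⟩ hxy
  rw [Real.cot_eq_cos_div_sin, Real.cot_eq_cos_div_sin,
    div_lt_div_iff₀ (Real.sin_pos_of_pos_of_lt_pi hy0 hy1) (Real.sin_pos_of_pos_of_lt_pi hx0 hx1)]
  have h := Real.sin_pos_of_pos_of_lt_pi (sub_pos.2 hxy) (by linarith)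
  rw [Real.sin_sub] at h
  linarith

theorem Real.two_div_cot_mul_sin_cube_sub {x : ℝ} (hx : x ∈ Set.Ioo 0 (Real.pi / 2)) :
    2 / (3 * Real.cot x * Real.sin x ^ 3) - Real.cot x / Real.sin x =
      (2 - 3 * Real.cos x ^ 2) / (3 * (Real.cos x * (1 - Real.cos x ^ 2))) := by
  have hs : Real.sin x ≠ 0 :=
    (Real.sin_pos_of_pos_of_lt_pi hx.1 (by linarith [hx.2, Real.pi_pos])).ne'
  have hc : Real.cos x ≠ 0 :=
    (Real.cos_pos_of_mem_Ioo ⟨by linarith [hx.1, Real.pi_pos], hx.2⟩).ne'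
  rw [Real.cot_eq_cos_div_sin, ← Real.sin_sq]
  field_simp

/-- The function `f(x) = sinh(2/(3 cot x sin³x) − cot x/sin x) − cot x` is strictly
increasing on `(0, π/2)`. -/
theorem stmt_12 :
    StrictMonoOn
      (fun x : ℝ =>
        Real.sinh (2 / (3 * Real.cot x * Real.sin x ^ 3) - Real.cot x / Real.sin x)
          - Real.cot x)
      (Set.Ioo 0 (Real.pi / 2)) := by
  have hcos : ∀ x ∈ Set.Ioo 0 (Real.pi / 2), Real.cos x ∈ Set.Ioo (0 : ℝ) 1 := fun x hx =>
    ⟨Real.cos_pos_of_mem_Ioo ⟨by linarith [hx.1, Real.pi_pos], hx.2⟩, by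
      simpa using Real.cos_lt_cos_of_nonneg_of_le_pi_div_two le_rfl hx.2.le hx.1⟩
  intro x hx y hy hxy
  dsimp only
  rw [Real.two_div_cot_mul_sin_cube_sub hx, Real.two_div_cot_mul_sin_cube_sub hy]
  refine sub_lt_sub (Real.sinh_strictMono ?_) ?_
  · exact strictAntiOn_two_sub_three_sq_div (hcos y hy) (hcos x hx)
      (Real.cos_lt_cos_of_nonneg_of_le_pi_div_two hx.1.le hy.2.le hxy)
  · exact Real.strictAntiOn_cot ⟨hx.1, by linarith [hx.2, Real.pi_pos]⟩
      ⟨hy.1, by linarith [hy.2, Real.pi_pos]⟩ hxy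
end

section
/- Fix y > 0 and define F(x, y) = ∫_1^x √( ((u − x)² + y²)(u² − 1) ) du for x > 1 (real square root). Then for every x > 1, the function t ↦ F(t, y) has derivative at t = x equal to y·√(x² − 1) + ∫_1^x ( (x − u)(u² − 1) ) / √( ((u − x)² + y²)(u² − 1) ) du, and this derivative is strictly positive. -/
open Filter Topology MeasureTheory

/-- The integral of a jointly continuous function over a short interval `[x, s]`, with the
parameter also equal to `s`, has derivative `f x x` at `s = x`. -/
theorem hasDerivAt_integral_self_of_continuous {f : ℝ → ℝ → ℝ}
    (hf : Continuous (Function.uncurry f)) (x : ℝ) :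
    HasDerivAt (fun s => ∫ u in x..s, f s u) (f x x) x := by
  rw [hasDerivAt_iff_isLittleO, Asymptotics.isLittleO_iff]
  intro c hc
  obtain ⟨δ, hδ, h⟩ := Metric.continuousAt_iff.1 (hf.continuousAt (x := (x, x))) c hc
  filter_upwards [Metric.ball_mem_nhds x hδ] with s hs
  have hint : IntervalIntegrable (f s) volume x s :=
    (hf.comp (Continuous.prodMk_right s)).intervalIntegrable _ _
  have key : (∫ u in x..s, f s u) - (∫ u in x..x, f x u) - (s - x) • f x x
      = ∫ u in x..s, (f s u - f x x) := by
    rw [intervalIntegral.integral_sub hint intervalIntegrable_const]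
    simp
  rw [key]
  refine intervalIntegral.norm_integral_le_of_norm_le_const fun u hu => ?_
  have hu' : dist u x ≤ dist s x := by
    rw [Real.dist_eq, Real.dist_eq]
    exact Set.abs_sub_left_of_mem_uIcc (Set.uIoc_subset_uIcc hu)
  have hdist : dist (s, u) (x, x) < δ := by
    rw [Prod.dist_eq]
    exact max_lt hs (hu'.trans_lt hs)
  exact (h hdist).le

/-- **Leibniz integral rule** with variable upper limit, for a jointly continuous function with
jointly continuous derivative in the parameter. -/
theorem hasDerivAt_integral_leibniz {f f' : ℝ → ℝ → ℝ}
    (hf : Continuous (Function.uncurry f)) (hf' : Continuous (Function.uncurry f'))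
    (hderiv : ∀ s u, HasDerivAt (fun t => f t u) (f' s u) s) (a x : ℝ) :
    HasDerivAt (fun s => ∫ u in a..s, f s u) (f x x + ∫ u in a..x, f' x u) x := by
  have hc (s : ℝ) : Continuous (f s) := hf.comp (Continuous.prodMk_right s)
  have hc' (s : ℝ) : Continuous (f' s) := hf'.comp (Continuous.prodMk_right s)
  obtain ⟨C, hC⟩ := ((isCompact_closedBall x 1).prod (isCompact_uIcc (a := a) (b := x))
    ).exists_bound_of_continuousOn hf'.continuousOn
  have hfix := (intervalIntegral.hasDerivAt_integral_of_dominated_loc_of_deriv_le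
    (F := f) (F' := f') (μ := volume) (a := a) (b := x) (bound := fun _ => C)
    (Metric.closedBall_mem_nhds x one_pos)
    (Eventually.of_forall fun s => (hc s).aestronglyMeasurable)
    ((hc x).intervalIntegrable _ _) (hc' x).aestronglyMeasurable
    (Eventually.of_forall fun u hu s hs => hC (s, u) ⟨hs, Set.uIoc_subset_uIcc hu⟩)
    intervalIntegrable_const
    (Eventually.of_forall fun u _ s _ => hderiv s u)).2
  have hsum := (hasDerivAt_integral_self_of_continuous hf x).add hfix
  refine hsum.congr_of_eventuallyEq (Eventually.of_forall fun s => ?_)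
  simp only [Pi.add_apply]
  rw [add_comm, intervalIntegral.integral_add_adjacent_intervals
    ((hc s).intervalIntegrable _ _) ((hc s).intervalIntegrable _ _)]

/-- For fixed `y > 0` and `x > 1`, the function
`t ↦ F(t,y) = ∫_1^t √(((u−t)² + y²)(u²−1)) du` has derivative at `t = x` equal to
`y√(x²−1) + ∫_1^x (x−u)(u²−1)/√(((u−x)²+y²)(u²−1)) du`, and this derivative is
strictly positive. -/
theorem stmt_16 (y : ℝ) (hy : 0 < y) (x : ℝ) (hx : 1 < x) :
    HasDerivAt
        (fun s : ℝ => ∫ u in (1 : ℝ)..s, Real.sqrt (((u - s) ^ 2 + y ^ 2) * (u ^ 2 - 1)))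
        (y * Real.sqrt (x ^ 2 - 1)
          + ∫ u in (1 : ℝ)..x,
              ((x - u) * (u ^ 2 - 1)) / Real.sqrt (((u - x) ^ 2 + y ^ 2) * (u ^ 2 - 1))) x
      ∧ 0 < y * Real.sqrt (x ^ 2 - 1)
          + ∫ u in (1 : ℝ)..x,
              ((x - u) * (u ^ 2 - 1)) / Real.sqrt (((u - x) ^ 2 + y ^ 2) * (u ^ 2 - 1)) := by
  have hpos (s u : ℝ) : 0 < (u - s) ^ 2 + y ^ 2 := by positivity
  constructor
  · have hf' : Continuous (Function.uncurry fun s u : ℝ =>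
        (s - u) / √((u - s) ^ 2 + y ^ 2) * √(u ^ 2 - 1)) := by
      refine Continuous.mul (Continuous.div (by fun_prop) (by fun_prop) fun p => ?_)
        (by fun_prop)
      exact (Real.sqrt_pos.2 (hpos p.1 p.2)).ne'
    have hderiv (s u : ℝ) : HasDerivAt (fun t => √(((u - t) ^ 2 + y ^ 2) * (u ^ 2 - 1)))
        ((s - u) / √((u - s) ^ 2 + y ^ 2) * √(u ^ 2 - 1)) s := by
      simp only [Real.sqrt_mul (hpos _ u).le]
      have h := ((((hasDerivAt_id s).const_sub u).pow 2).add_const (y ^ 2)).sqrt (hpos s u).ne'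
      refine (h.mul_const √(u ^ 2 - 1)).congr_deriv ?_
      have := (Real.sqrt_pos.2 (hpos s u)).ne'
      simp only [id, Pi.pow_apply]
      field_simp
      ring
    have h := hasDerivAt_integral_leibniz
      (f := fun s u => √(((u - s) ^ 2 + y ^ 2) * (u ^ 2 - 1))) (by fun_prop) hf' hderiv 1 x
    convert h using 2
    · rw [Real.sqrt_mul (hpos x x).le]
      simp [Real.sqrt_sq hy.le]
    · refine intervalIntegral.integral_congr fun u _ => ?_
      rw [Real.sqrt_mul (hpos x u).le, mul_div_mul_comm, Real.div_sqrt]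
  · refine add_pos_of_pos_of_nonneg (mul_pos hy (Real.sqrt_pos.2 (by nlinarith))) ?_
    refine intervalIntegral.integral_nonneg hx.le fun u hu => ?_
    exact div_nonneg (mul_nonneg (sub_nonneg.2 hu.2) (by nlinarith [hu.1])) (Real.sqrt_nonneg _)
end
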